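/- arXiv:1703.04169 — 2 statements merged into one kernel-verified Lean document; each statement's English description precedes it below -/
import Mathlib

section
/- Let G be a group, F the free group with basis {e₁, e₂, …}, and work in the free product G * F. Suppose that for all non-commuting u, v ∈ G * F with at least one of u, v cyclically reduced (with respect to the splitting G * F), we have u⁵v⁴ ≠ e₁. Then for all non-commuting u, v ∈ G * F (without any reducedness assumption) we have u⁵v⁴ ≠ e₁. -/
open Monoid

/-- The two factors of the free product `G * F` where `F` is the free group of
countably infinite rank. -/
def Fac (G : Type) : Bool → Type
  | true => G
  | false => FreeGroup ℕ

instance instFacGroup (G : Type) [Group G] : ∀ i, Group (Fac G i) := fun i =>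
  match i with
  | true => inferInstanceAs (Group G)
  | false => inferInstanceAs (Group (FreeGroup ℕ))

/-- The generator `e₁` of `F`, as an element of the factor `Fac G false`. -/
def fGen (G : Type) : Fac G false := FreeGroup.of 0

/-- The basis element `e₁` of the free factor `F`, inside `G * F`. -/
def eOne (G : Type) [Group G] : CoprodI (Fac G) :=
  CoprodI.of (fGen G)

/-- A reduced word is cyclically reduced if it has length at most 1 or its first
and last letters lie in different free factors. -/
def CyclicallyReducedWord {ι : Type*} {N : ι → Type*} [∀ i, Monoid (N i)]
    (w : CoprodI.Word N) : Prop :=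
  w.toList.length ≤ 1 ∨ ∀ a ∈ w.toList.head?, ∀ b ∈ w.toList.getLast?, a.1 ≠ b.1

/-- An element of the free product is cyclically reduced if its normal form is. -/
def CyclicallyReduced {ι : Type*} {N : ι → Type*} [∀ i, Monoid (N i)]
    (g : CoprodI N) : Prop :=
  ∃ w : CoprodI.Word N, w.prod = g ∧ CyclicallyReducedWord w

open Monoid CoprodI in
/-- The words of the free product that start in the factor `i` and end in the factor `j`. -/
def HasEnds {ι : Type*} {N : ι → Type*} [∀ i, Monoid (N i)] (i j : ι) (g : CoprodI N) : Prop :=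
  ∃ w : NeWord N i j, w.prod = g

namespace HasEnds

open Monoid CoprodI

section Monoid

variable {ι : Type*} {N : ι → Type*} [∀ i, Monoid (N i)] {i j k l : ι} {g g' : CoprodI N}

theorem of {m : N i} (hm : m ≠ 1) : HasEnds i i (CoprodI.of m) :=
  ⟨.singleton m hm, by simp⟩

theorem mul (hg : HasEnds i j g) (hne : j ≠ k) (hg' : HasEnds k l g') : HasEnds i l (g * g') := by
  obtain ⟨w, rfl⟩ := hg
  obtain ⟨w', rfl⟩ := hg'
  exact ⟨.append w hne w', by simp⟩

theorem ends_eq (hg : HasEnds i j g) (hg' : HasEnds k l g) : i = k ∧ j = l := by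
  classical
  obtain ⟨w, rfl⟩ := hg
  obtain ⟨w', hw'⟩ := hg'
  have h : w'.toList = w.toList :=
    congrArg Word.toList (Word.equiv.symm.injective (a₁ := w'.toWord) (a₂ := w.toWord) hw')
  have hh := w'.toList_head?
  have hl := w'.toList_getLast?
  rw [h, NeWord.toList_head?] at hh
  rw [h, NeWord.toList_getLast?] at hl
  simp only [Option.some.injEq, Sigma.mk.injEq] at hh hl
  exact ⟨hh.1, hl.1⟩

theorem ne_one (hg : HasEnds i j g) : g ≠ 1 := by
  classical
  obtain ⟨w, rfl⟩ := hg
  intro hw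
  have h : w.toWord = Word.empty :=
    Word.equiv.symm.injective (a₁ := w.toWord) (a₂ := Word.empty) (hw.trans Word.prod_empty.symm)
  exact w.toList_ne_nil (congrArg Word.toList h)

theorem exists_of_ne_one (hg : g ≠ 1) : ∃ i j, HasEnds i j g := by
  classical
  obtain ⟨i, j, w, hw⟩ := NeWord.of_word (Word.equiv g) fun h ↦ hg <| by
    have := Word.equiv.symm_apply_apply g
    rw [h] at this
    exact this.symm.trans Word.prod_empty
  exact ⟨i, j, w, by rw [NeWord.prod, hw]; exact Word.equiv.symm_apply_apply g⟩

theorem cyclicallyReduced (hg : HasEnds i j g) (hij : i ≠ j) : CyclicallyReduced g := by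
  obtain ⟨w, rfl⟩ := hg
  refine ⟨w.toWord, rfl, Or.inr ?_⟩
  intro a ha b hb
  have ha' : some a = some ⟨i, w.head⟩ := ha.symm.trans w.toList_head?
  have hb' : some b = some ⟨j, w.last⟩ := hb.symm.trans w.toList_getLast?
  rw [Option.some.injEq] at ha' hb'
  subst ha' hb'
  exact hij

end Monoid

section Group

variable {ι : Type*} {N : ι → Type*} [∀ i, Group (N i)] {i j : ι} {g : CoprodI N}

theorem inv (hg : HasEnds i j g) : HasEnds j i g⁻¹ := by
  obtain ⟨w, rfl⟩ := hg
  exact ⟨w.inv, by simp⟩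

end Group

end HasEnds

namespace Monoid.CoprodI

section Monoid

variable {ι : Type*} {N : ι → Type*} [∀ i, Monoid (N i)]

theorem cyclicallyReduced_one : CyclicallyReduced (1 : CoprodI N) :=
  ⟨Word.empty, Word.prod_empty, Or.inl (by simp [Word.empty])⟩

theorem cyclicallyReduced_of {i : ι} (m : N i) : CyclicallyReduced (of m) := by
  by_cases hm : m = 1
  · rw [hm, map_one]
    exact cyclicallyReduced_one
  · exact ⟨(NeWord.singleton m hm).toWord, NeWord.prod_singleton m hm,
      Or.inl (by simp [NeWord.toWord])⟩

/-- A reduced word is a letter or splits off its first letter. -/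
theorem NeWord.exists_prod_eq_of_mul {i j : ι} (w : NeWord N i j) :
    (∃ m : N i, m ≠ 1 ∧ i = j ∧ w.prod = of m) ∨
      ∃ (a : N i) (k : ι) (w' : NeWord N k j), a ≠ 1 ∧ i ≠ k ∧ w.prod = of a * w'.prod ∧
        w'.toList.length < w.toList.length := by
  induction w with
  | singleton x hx => exact Or.inl ⟨x, hx, rfl, by simp⟩
  | append w₁ hne w₂ ih₁ _ =>
    right
    rcases ih₁ with ⟨m, hm, rfl, h⟩ | ⟨a, k, w', ha, hk, h, hlt⟩
    · exact ⟨m, _, w₂, hm, hne, by simp [h],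
        by simpa using List.length_pos_iff.2 w₁.toList_ne_nil⟩
    · exact ⟨a, k, .append w' hne w₂, ha, hk, by simp [h, mul_assoc], by simpa using hlt⟩

/-- A reduced word is a letter or splits off its last letter. -/
theorem NeWord.exists_prod_eq_mul_of {i j : ι} (w : NeWord N i j) :
    (∃ m : N j, m ≠ 1 ∧ i = j ∧ w.prod = of m) ∨
      ∃ (b : N j) (k : ι) (w' : NeWord N i k), b ≠ 1 ∧ k ≠ j ∧ w.prod = w'.prod * of b ∧
        w'.toList.length < w.toList.length := by
  induction w with
  | singleton x hx => exact Or.inl ⟨x, hx, rfl, by simp⟩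
  | append w₁ hne w₂ _ ih₂ =>
    right
    rcases ih₂ with ⟨m, hm, rfl, h⟩ | ⟨b, k, w', hb, hk, h, hlt⟩
    · exact ⟨m, _, w₁, hm, hne, by simp [h],
        by simpa using List.length_pos_iff.2 w₂.toList_ne_nil⟩
    · exact ⟨b, k, .append w₁ hne w', hb, hk, by simp [h, mul_assoc], by simpa using hlt⟩

/-- A reduced word with both ends in the factor `i` is a letter or splits off both its first and
its last letter. -/
theorem NeWord.exists_prod_eq_of_mul_of {i : ι} (w : NeWord N i i) :
    (∃ m : N i, w.prod = of m) ∨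
      ∃ (a b : N i) (k l : ι) (w' : NeWord N k l), a ≠ 1 ∧ b ≠ 1 ∧ i ≠ k ∧ l ≠ i ∧
        w.prod = of a * w'.prod * of b ∧ w'.toList.length < w.toList.length := by
  rcases w.exists_prod_eq_of_mul with ⟨m, -, -, h⟩ | ⟨a, k, w', ha, hk, h, hlt⟩
  · exact Or.inl ⟨m, h⟩
  · rcases w'.exists_prod_eq_mul_of with ⟨-, -, rfl, -⟩ | ⟨b, l, w'', hb, hl, h', hlt'⟩
    · exact absurd rfl hk
    · exact Or.inr ⟨a, b, k, l, w'', ha, hb, hk, hl, by rw [h, h', mul_assoc], hlt'.trans hlt⟩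

/-- Factorwise injective homomorphisms preserve cyclic reducedness. -/
theorem CyclicallyReduced.lift_of_comp {N' : ι → Type*} [∀ i, Monoid (N' i)]
    (φ : ∀ i, N i →* N' i) (hφ : ∀ i m, φ i m = 1 → m = 1) {g : CoprodI N}
    (hg : CyclicallyReduced g) : CyclicallyReduced (lift (fun i ↦ of.comp (φ i)) g) := by
  obtain ⟨w, rfl, hw⟩ := hg
  let f : (Σ i, N i) → Σ i, N' i := fun x ↦ ⟨x.1, φ x.1 x.2⟩
  refine ⟨⟨w.toList.map f, ?_, ?_⟩, ?_, ?_⟩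
  · intro l hl
    obtain ⟨x, hx, rfl⟩ := List.mem_map.1 hl
    exact fun h ↦ w.ne_one x hx (hφ _ _ h)
  · exact (List.isChain_map f).2 w.chain_ne
  · simp only [Word.prod, map_list_prod, List.map_map]
    congr 1
  · rcases hw with hw | hw
    · exact Or.inl (by simpa using hw)
    · refine Or.inr fun a ha b hb ↦ ?_
      simp only [List.head?_map, List.getLast?_map, Option.mem_def, Option.map_eq_some_iff] at ha hb
      obtain ⟨a', ha', rfl⟩ := ha
      obtain ⟨b', hb', rfl⟩ := hb
      exact hw a' ha' b' hb'

end Monoid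

section Bool

variable {N : Bool → Type*} [∀ i, Group (N i)]

/-- In a free product of two groups, powers of a word with both ends in the factor `i` are trivial
or again have both ends in the factor `i`. -/
theorem NeWord.prod_pow_eq_one_or_hasEnds {i : Bool} (w : NeWord N i i) (n : ℕ) :
    w.prod ^ n = 1 ∨ HasEnds i i (w.prod ^ n) := by
  rcases w.exists_prod_eq_of_mul_of with ⟨m, h⟩ | ⟨a, b, k, l, w', ha, hb, hk, hl, h, hlt⟩
  · rw [h, ← map_pow]
    by_cases hm : m ^ n = 1
    · exact Or.inl (by rw [hm, map_one])
    · exact Or.inr (.of hm)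
  obtain rfl : l = k := by
    revert hk hl
    cases i <;> cases k <;> cases l <;> simp
  rw [h]
  by_cases hba : b * a = 1
  · obtain rfl : b = a⁻¹ := eq_inv_of_mul_eq_one_left hba
    rw [map_inv, conj_pow]
    rcases w'.prod_pow_eq_one_or_hasEnds n with hw | hw
    · exact Or.inl (by simp [hw])
    · exact Or.inr (by rw [← map_inv]; exact ((HasEnds.of ha).mul hk hw).mul hl (.of hb))
  · cases n with
    | zero => exact Or.inl (pow_zero _)
    | succ n =>
      right
      have hmid : ∀ n : ℕ, HasEnds l l ((w'.prod * of (b * a)) ^ n * w'.prod) := by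
        intro n
        induction n with
        | zero => simpa using ⟨w', rfl⟩
        | succ n ih =>
          rw [pow_succ', mul_assoc]
          exact (HasEnds.mul ⟨w', rfl⟩ hl (.of hba)).mul hk ih
      have heq : ∀ n : ℕ, (of a * w'.prod * of b) ^ (n + 1) =
          of a * ((w'.prod * of (b * a)) ^ n * w'.prod) * of b := by
        intro n
        induction n with
        | zero => simp [mul_assoc]
        | succ n ih =>
          rw [pow_succ', ih, pow_succ' (w'.prod * of (b * a)), map_mul]
          simp only [mul_assoc]
      rw [heq]
      exact ((HasEnds.of ha).mul hk (hmid n)).mul hl (.of hb)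
termination_by w.toList.length

/-- Up to conjugation by a letter `f` of the factor `i`, every element of a free product of two
groups is cyclically reduced or has all its powers trivial or starting and ending in the other
factor. -/
theorem exists_conj_cyclicallyReduced_or_hasEnds_pow {i j : Bool} (hij : i ≠ j) (u : CoprodI N) :
    ∃ f : N i, CyclicallyReduced ((of f)⁻¹ * u * of f) ∨
      ∀ n : ℕ, (of f)⁻¹ * u ^ n * of f = 1 ∨ HasEnds j j ((of f)⁻¹ * u ^ n * of f) := by
  by_cases hu : u = 1
  · exact ⟨1, Or.inl (by simpa [hu] using cyclicallyReduced_one)⟩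
  obtain ⟨p, q, hpq⟩ := HasEnds.exists_of_ne_one hu
  by_cases hne : p ≠ q
  · exact ⟨1, Or.inl (by simpa using hpq.cyclicallyReduced hne)⟩
  obtain rfl : p = q := not_not.1 hne
  obtain ⟨w, rfl⟩ := hpq
  by_cases hp : p = j
  · subst hp
    exact ⟨1, Or.inr fun n ↦ by simpa using w.prod_pow_eq_one_or_hasEnds n⟩
  obtain rfl : i = p := by
    revert hij hp
    cases i <;> cases j <;> cases p <;> simp
  rcases w.exists_prod_eq_of_mul_of with ⟨m, h⟩ | ⟨a, b, k, l, w', ha, hb, hk, hl, h, -⟩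
  · exact ⟨1, Or.inl (by simpa [h] using cyclicallyReduced_of m)⟩
  obtain ⟨rfl, rfl⟩ : j = k ∧ j = l := by
    revert hij hk hl
    cases i <;> cases j <;> cases k <;> cases l <;> simp
  refine ⟨a, ?_⟩
  by_cases hba : b * a = 1
  · right
    intro n
    have heq : (of a)⁻¹ * w.prod ^ n * of a = w'.prod ^ n := by
      rw [h, eq_inv_of_mul_eq_one_left hba, map_inv, conj_pow]
      group
    rw [heq]
    exact w'.prod_pow_eq_one_or_hasEnds n
  · left
    have heq : (of a)⁻¹ * w.prod * of a = w'.prod * of (b * a) := by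
      rw [h, map_mul]
      group
    rw [heq]
    exact (HasEnds.mul ⟨w', rfl⟩ hl (.of hba)).cyclicallyReduced hij.symm

end Bool

/-- Letters of a factor `i` that carry trivial elements or words with both ends in another factor
`j` to such elements have trivial product. -/
theorem mul_eq_one_of_of_mul_mul_of {ι : Type*} {N : ι → Type*} [∀ i, Group (N i)] {i j : ι}
    (hij : i ≠ j) {s t : N i} {y z : CoprodI N} (hy : y = 1 ∨ HasEnds j j y)
    (hz : z = 1 ∨ HasEnds j j z) (h : of s * y * of t = z) : s * t = 1 := by
  by_contra hst
  rcases hy with rfl | hy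
  · rw [mul_one, ← map_mul] at h
    rcases hz with rfl | hz
    · exact (HasEnds.of hst).ne_one h
    · exact hij ((HasEnds.of hst).ends_eq (h ▸ hz)).1
  by_cases hs : s = 1
  · subst hs
    rw [one_mul] at hst
    have h' : HasEnds j i z := by
      rw [← h, map_one, one_mul]
      exact hy.mul hij.symm (.of hst)
    rcases hz with rfl | hz
    · exact h'.ne_one rfl
    · exact hij (h'.ends_eq hz).2
  have hsy : HasEnds i j (of s * y) := (HasEnds.of hs).mul hij hy
  by_cases ht : t = 1
  · subst ht
    rw [map_one, mul_one] at h
    rcases hz with rfl | hz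
    · exact hsy.ne_one h
    · exact hij (hsy.ends_eq (h ▸ hz)).1
  have h' : HasEnds i i z := h ▸ hsy.mul hij.symm (.of ht)
  rcases hz with rfl | hz
  · exact h'.ne_one rfl
  · exact hij (h'.ends_eq hz).1

end Monoid.CoprodI

section FactorConj

variable {G : Type} [Group G]

/-- Conjugation by `f` on the free factor and the identity on `G`. -/
def factorConj (f : Fac G false) : ∀ i, Fac G i →* Fac G i
  | true => MonoidHom.id _
  | false => (MulAut.conj f).toMonoidHom

theorem factorConj_eq_one (f : Fac G false) :
    ∀ (i : Bool) (m : Fac G i), factorConj f i m = 1 → m = 1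
  | true, _, h => h
  | false, _, h => (MulEquiv.map_eq_one_iff (MulAut.conj f)).1 h

theorem factorConj_inv_apply (f : Fac G false) :
    ∀ (i : Bool) (m : Fac G i), factorConj f⁻¹ i (factorConj f i m) = m
  | true, _ => rfl
  | false, m => by
    change f⁻¹ * (f * m * f⁻¹) * f⁻¹⁻¹ = m
    group

open Monoid CoprodI in
/-- The endomorphism of the free product induced by `factorConj`. -/
def factorConjHom (f : Fac G false) : CoprodI (Fac G) →* CoprodI (Fac G) :=
  lift fun i ↦ of.comp (factorConj f i)

open Monoid CoprodI in
theorem factorConjHom_of (f m : Fac G false) :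
    factorConjHom f (of m) = of (f * m * f⁻¹) := by
  rw [factorConjHom, lift_of]
  rfl

open Monoid CoprodI in
theorem factorConjHom_injective (f : Fac G false) : Function.Injective (factorConjHom f) := by
  have h : (factorConjHom f⁻¹).comp (factorConjHom f) = MonoidHom.id _ := by
    refine ext_hom _ _ fun i ↦ MonoidHom.ext fun m ↦ ?_
    simp [factorConjHom, factorConj_inv_apply]
  exact Function.LeftInverse.injective (g := factorConjHom f⁻¹) fun x ↦ DFunLike.congr_fun h x

open Monoid CoprodI in
/-- Conjugation by `f⁻¹` on `G` and the identity on the free factor. -/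
def partialConj (f : Fac G false) : CoprodI (Fac G) →* CoprodI (Fac G) :=
  (factorConjHom f).comp (MulAut.conj (of f)⁻¹).toMonoidHom

open Monoid CoprodI in
theorem partialConj_apply (f : Fac G false) (x : CoprodI (Fac G)) :
    partialConj f x = factorConjHom f ((of f)⁻¹ * x * of f) := by
  simp [partialConj]

theorem partialConj_injective (f : Fac G false) : Function.Injective (partialConj f) :=
  (factorConjHom_injective f).comp (MulEquiv.injective _)

theorem partialConj_eOne (f : Fac G false) : partialConj f (eOne G) = eOne G := by
  rw [partialConj_apply, eOne, ← map_inv, ← map_mul, ← map_mul, factorConjHom_of]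
  congr 1
  group

open Monoid CoprodI in
theorem cyclicallyReduced_partialConj {f : Fac G false} {x : CoprodI (Fac G)}
    (hx : CyclicallyReduced ((of f)⁻¹ * x * of f)) : CyclicallyReduced (partialConj f x) := by
  rw [partialConj_apply]
  exact CyclicallyReduced.lift_of_comp _ (factorConj_eq_one f) hx

theorem fGen_ne_one : fGen G ≠ 1 :=
  FreeGroup.of_ne_one 0

end FactorConj

/-- If `u⁵v⁴ ≠ e₁` holds for all non-commuting `u, v ∈ G * F` at least one of
which is cyclically reduced, then it holds for all non-commuting `u, v`. -/
theorem stmt15 (G : Type) [Group G]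
    (h : ∀ u v : CoprodI (Fac G), u * v ≠ v * u →
      (CyclicallyReduced u ∨ CyclicallyReduced v) → u ^ 5 * v ^ 4 ≠ eOne G) :
    ∀ u v : CoprodI (Fac G), u * v ≠ v * u → u ^ 5 * v ^ 4 ≠ eOne G := by
  intro u v huv huv'
  have key : ∀ f : Fac G false, ¬(CyclicallyReduced ((CoprodI.of f)⁻¹ * u * CoprodI.of f) ∨
      CyclicallyReduced ((CoprodI.of f)⁻¹ * v * CoprodI.of f)) := by
    intro f hf
    refine h (partialConj f u) (partialConj f v) ?_
      (hf.imp cyclicallyReduced_partialConj cyclicallyReduced_partialConj) ?_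
    · rw [← map_mul, ← map_mul]
      exact (partialConj_injective f).ne huv
    · rw [← map_pow, ← map_pow, ← map_mul, huv', partialConj_eOne]
  obtain ⟨f, hf⟩ :=
    CoprodI.exists_conj_cyclicallyReduced_or_hasEnds_pow (j := true) Bool.false_ne_true u
  obtain ⟨f', hf'⟩ :=
    CoprodI.exists_conj_cyclicallyReduced_or_hasEnds_pow (j := true) Bool.false_ne_true v
  have hu := hf.resolve_left (fun hc ↦ key f (Or.inl hc)) 5
  have hv := hf'.resolve_left (fun hc ↦ key f' (Or.inr hc)) 4
  have hst := CoprodI.mul_eq_one_of_of_mul_mul_of (s := f'⁻¹ * f) (t := f⁻¹ * fGen G * f')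
    Bool.false_ne_true (hu.imp inv_eq_one.2 HasEnds.inv) hv <| by
      rw [eq_inv_mul_of_mul_eq huv']
      simp only [map_mul, map_inv, eOne]
      group
  refine fGen_ne_one (G := G) ?_
  have heq : f'⁻¹ * f * (f⁻¹ * fGen G * f') = f'⁻¹ * fGen G * f'⁻¹⁻¹ := by group
  rwa [heq, conj_eq_one_iff] at hst
end

section
/- If u, v are elements of a free group F with u⁵v⁴ = e₁ for a basis element e₁ of F, then u and v commute. -/
/-- A twisted derivation of a subgroup `H` of a free group can be normalised on any free generator
lying in `H`: it is induced from a cocycle of the action of the free group on itself. -/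
theorem exists_derivation_of_freeGroup_of_mem {ι K : Type*} [CommRing K]
    (H : Subgroup (FreeGroup ι)) (χ : H →* Kˣ) (i : ι) (hi : FreeGroup.of i ∈ H) :
    ∃ δ : H → K, (∀ g h, δ (g * h) = χ h * δ g + δ h) ∧ δ ⟨FreeGroup.of i, hi⟩ = 1 := by
  classical
  let f : FreeGroup ι → K := fun x => if hx : x ∈ H then (χ ⟨x, hx⟩ : K) else 0
  have hf (x : FreeGroup ι) (h : H) : f (x * h) = χ h * f x := by
    by_cases hx : x ∈ H
    · have hxh : x * h ∈ H := H.mul_mem hx h.2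
      have : (⟨x * h, hxh⟩ : H) = ⟨x, hx⟩ * h := rfl
      simp only [f, dif_pos hx, dif_pos hxh, this, map_mul, Units.val_mul, mul_comm]
    · have hxh : x * h ∉ H := fun hxh => hx ((H.mul_mem_cancel_right h.2).1 hxh)
      simp [f, dif_neg hx, dif_neg hxh]
  let c : ι → FreeGroup ι → K := fun j x => if j = i then f x else 0
  have hc (j : ι) (x : FreeGroup ι) (h : H) : c j (x * h) = χ h * c j x := by
    by_cases hj : j = i <;> simp [c, hj, hf]
  let σ : ι → Equiv.Perm (FreeGroup ι × K) := fun j =>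
    { toFun := fun p => (FreeGroup.of j * p.1, p.2 + c j p.1)
      invFun := fun p => ((FreeGroup.of j)⁻¹ * p.1, p.2 - c j ((FreeGroup.of j)⁻¹ * p.1))
      left_inv := fun p => by simp
      right_inv := fun p => by simp }
  let ρ : FreeGroup ι →* Equiv.Perm (FreeGroup ι × K) := FreeGroup.lift σ
  have hρσ (j : ι) : ρ (FreeGroup.of j) = σ j := FreeGroup.lift_apply_of
  let P : H → K → Equiv.Perm (FreeGroup ι × K) := fun h t =>
    { toFun := fun p => (p.1 * h, χ h * p.2 + t)
      invFun := fun p => (p.1 * (h : FreeGroup ι)⁻¹, ((χ h)⁻¹ : Kˣ) * (p.2 - t))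
      left_inv := fun p => by simp
      right_inv := fun p => by simp }
  have fst_ρ (g : FreeGroup ι) : ∀ p, (ρ g p).1 = g * p.1 := by
    induction g using FreeGroup.induction_on with
    | C1 => simp
    | of j => intro p; rw [hρσ]; rfl
    | inv_of j _ => intro p; rw [map_inv, hρσ]; rfl
    | mul g h hg hh => intro p; rw [map_mul, Equiv.Perm.mul_apply, hg, hh, mul_assoc]
  have commute_ρ (h : H) (t : K) (g : FreeGroup ι) : Commute (P h t) (ρ g) := by
    induction g using FreeGroup.induction_on with
    | C1 => simp
    | of j =>
      rw [hρσ]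
      ext p
      · simp [P, σ, mul_assoc]
      · simp [P, σ, hc]; ring
    | inv_of j hj => rw [map_inv]; exact hj.inv_right
    | mul g g' hg hg' => rw [map_mul]; exact hg.mul_right hg'
  refine ⟨fun h => (ρ h (1, 0)).2, fun g h => ?_, ?_⟩
  · have key : ρ h (1, 0) = P h (ρ h (1, 0)).2 (1, 0) :=
      Prod.ext (by simp [fst_ρ, P]) (by simp [P])
    have := DFunLike.congr_fun (commute_ρ h (ρ h (1, 0)).2 g).eq (1, 0)
    rw [Equiv.Perm.mul_apply, Equiv.Perm.mul_apply, ← key] at this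
    dsimp only
    rw [Subgroup.coe_mul, map_mul, Equiv.Perm.mul_apply, ← this]
    rfl
  · have h1 : f 1 = 1 := by
      have : (⟨1, H.one_mem⟩ : H) = 1 := rfl
      simp [f, dif_pos H.one_mem, this]
    simp [hρσ, σ, c, h1]

/-- A free group generated by two non-commuting elements has homomorphisms to a finite group
with prescribed values on these elements. -/
theorem IsFreeGroup.exists_hom_of_not_commute {G A : Type*} [Group G] [IsFreeGroup G] [Group A]
    [Finite A] {u v : G} (hgen : Subgroup.closure {u, v} = ⊤) (huv : ¬ Commute u v) (a b : A) :
    ∃ φ : G →* A, φ u = a ∧ φ v = b := by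
  classical
  have : Nontrivial (IsFreeGroup.Generators G) := by
    by_contra hX
    rw [not_nontrivial_iff_subsingleton] at hX
    refine huv ((IsFreeGroup.toFreeGroup G).injective ?_)
    rw [map_mul, map_mul]
    cases isEmpty_or_nonempty (IsFreeGroup.Generators G) with
    | inl h => exact Subsingleton.elim _ _
    | inr h =>
      have := uniqueOfSubsingleton (Classical.arbitrary (IsFreeGroup.Generators G))
      exact mul_comm' _ _
  obtain ⟨x, y, hxy⟩ := exists_pair_ne (IsFreeGroup.Generators G)
  let φ : A × A → G →* A := fun p =>
    IsFreeGroup.lift fun z => if z = x then p.1 else if z = y then p.2 else 1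
  have hinj : Function.Injective fun p => (φ p u, φ p v) := by
    intro p q hpq
    have hφ : φ p = φ q := by
      refine MonoidHom.eq_of_eqOn_dense hgen ?_
      rintro z (rfl | rfl)
      · exact congrArg Prod.fst hpq
      · exact congrArg Prod.snd hpq
    have hx := DFunLike.congr_fun hφ (IsFreeGroup.of x)
    have hy := DFunLike.congr_fun hφ (IsFreeGroup.of y)
    simp only [φ, IsFreeGroup.lift_of, if_true] at hx
    simp only [φ, IsFreeGroup.lift_of, if_neg hxy.symm, if_true] at hy
    exact Prod.ext hx hy
  obtain ⟨p, hp⟩ := Finite.surjective_of_injective hinj (a, b)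
  exact ⟨φ p, congrArg Prod.fst hp, congrArg Prod.snd hp⟩

theorem commute_of_pow_five_mul_pow_four_eq_freeGroup_of {ι : Type*} {u v : FreeGroup ι} {i : ι}
    (h : u ^ 5 * v ^ 4 = FreeGroup.of i) : Commute u v := by
  by_contra huv
  let H := Subgroup.closure {u, v}
  have hu : u ∈ H := Subgroup.subset_closure (by simp)
  have hv : v ∈ H := Subgroup.subset_closure (by simp)
  let u' : H := ⟨u, hu⟩
  let v' : H := ⟨v, hv⟩
  have hgen : Subgroup.closure {u', v'} = ⊤ := by
    rw [← Subgroup.closure_closure_coe_preimage (k := {u, v})]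
    congr 1
    ext x
    simp [u', v', H, Subtype.ext_iff]
  have huv' : ¬ Commute u' v' := fun hc => huv (congrArg Subtype.val hc)
  obtain ⟨χ, hχu, hχv⟩ := IsFreeGroup.exists_hom_of_not_commute hgen huv'
    (⟨16, 18, by decide, by decide⟩ : (ZMod 41)ˣ) ⟨9, 32, by decide, by decide⟩
  have hi : FreeGroup.of i ∈ H := h ▸ H.mul_mem (H.pow_mem hu 5) (H.pow_mem hv 4)
  obtain ⟨δ, hδ, hδi⟩ := exists_derivation_of_freeGroup_of_mem H χ i hi
  have he : (⟨FreeGroup.of i, hi⟩ : H) = u' ^ 5 * v' ^ 4 := Subtype.ext h.symm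
  have h5 : δ (u' ^ 5) = 0 := by
    simp only [pow_succ, pow_zero, one_mul, hδ, hχu]
    generalize δ u' = t
    revert t
    decide
  have h4 : δ (v' ^ 4) = 0 := by
    simp only [pow_succ, pow_zero, one_mul, hδ, hχv]
    generalize δ v' = t
    revert t
    decide
  rw [he, hδ, h5, h4, mul_zero, add_zero] at hδi
  exact absurd hδi (by decide)

theorem stmt18 {F : Type*} [Group F] (e : F)
    (he : ∃ (ι : Type) (b : FreeGroupBasis ι F) (i : ι), b i = e)
    (u v : F) (h : u ^ 5 * v ^ 4 = e) :
    u * v = v * u := by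
  obtain ⟨ι, b, i, rfl⟩ := he
  have hcomm : Commute (b.repr u) (b.repr v) :=
    commute_of_pow_five_mul_pow_four_eq_freeGroup_of (i := i) (by
      rw [← map_pow, ← map_pow, ← map_mul, h, b.repr_apply_coe])
  exact b.repr.injective (by simpa only [map_mul] using hcomm.eq)
end
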